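/- Let [u,w] be a Bruhat interval in a Weyl group W. If the dual poset [u,w]* is a zircon, then [u,w] is rationally smooth, i.e. deg_{y,w}(y) = ℓ(w) − ℓ(y) for all y ∈ [u,w]. -/

import Mathlib

namespace Paper

/-! ### Bruhat order on a Coxeter group -/

variable {B W : Type*} [Group W] {M : CoxeterMatrix B}

/-- One step in the Bruhat order: multiply on the left by a reflection,
increasing the length. -/
def BruhatStep (cs : CoxeterSystem M W) (a b : W) : Prop :=
  ∃ t : W, cs.IsReflection t ∧ b = t * a ∧ cs.length a < cs.length b

/-- The Bruhat order on a Coxeter group. -/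
def BruhatLE (cs : CoxeterSystem M W) : W → W → Prop :=
  Relation.ReflTransGen (BruhatStep cs)

theorem BruhatLE.length_le {cs : CoxeterSystem M W} {a b : W} (h : BruhatLE cs a b) :
    cs.length a ≤ cs.length b := by
  induction h with
  | refl => exact le_rfl
  | tail _ h ih => obtain ⟨t, -, -, hlt⟩ := h; exact ih.trans hlt.le

theorem BruhatLE.length_lt {cs : CoxeterSystem M W} {a b : W} (h : BruhatLE cs a b)
    (hne : a ≠ b) : cs.length a < cs.length b := by
  rcases Relation.ReflTransGen.cases_head h with h' | ⟨c, hc, h'⟩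
  · exact absurd h' hne
  · obtain ⟨t, -, -, hlt⟩ := hc
    exact lt_of_lt_of_le hlt (BruhatLE.length_le h')

theorem BruhatLE.antisymm {cs : CoxeterSystem M W} {a b : W} (h1 : BruhatLE cs a b)
    (h2 : BruhatLE cs b a) : a = b := by
  by_contra hne
  exact absurd (BruhatLE.length_lt h1 hne) (not_lt.mpr (BruhatLE.length_le h2))

/-- The Bruhat interval `[u,w]`, as a type. -/
abbrev BruhatInterval (cs : CoxeterSystem M W) (u w : W) : Type _ :=
  {y : W // BruhatLE cs u y ∧ BruhatLE cs y w}

/-- The Bruhat interval `[u,w]` is a poset under the Bruhat order. -/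
instance (cs : CoxeterSystem M W) (u w : W) : PartialOrder (BruhatInterval cs u w) where
  le a b := BruhatLE cs a.1 b.1
  le_refl _ := Relation.ReflTransGen.refl
  le_trans _ _ _ := Relation.ReflTransGen.trans
  le_antisymm _ _ h1 h2 := Subtype.ext (BruhatLE.antisymm h1 h2)

/-- A principal order ideal `{v : v ≤ x}` of the Bruhat order, as a type. -/
abbrev BruhatIdeal (cs : CoxeterSystem M W) (x : W) : Type _ :=
  {v : W // BruhatLE cs v x}

/-- A principal order ideal of the Bruhat order is a poset under the Bruhat order. -/
instance (cs : CoxeterSystem M W) (x : W) : PartialOrder (BruhatIdeal cs x) where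
  le a b := BruhatLE cs a.1 b.1
  le_refl _ := Relation.ReflTransGen.refl
  le_trans _ _ _ := Relation.ReflTransGen.trans
  le_antisymm _ _ h1 h2 := Subtype.ext (BruhatLE.antisymm h1 h2)

/-! ### Posets: matchings, special matchings and zircons -/

/-- A matching of a poset: an involution matching each element with an element
covering it or covered by it. -/
def IsMatching {α : Type*} [PartialOrder α] (f : α → α) : Prop :=
  Function.Involutive f ∧ ∀ x : α, f x ⋖ x ∨ x ⋖ f x

/-- A special matching of a poset. -/
def IsSpecialMatching {α : Type*} [PartialOrder α] (f : α → α) : Prop :=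
  IsMatching f ∧ ∀ x y : α, x ⋖ y → f x = y ∨ f x < f y

/-- A zircon: a poset in which the principal order ideal of every non-minimal element is
finite and has a special matching. -/
def IsZircon (α : Type*) [PartialOrder α] : Prop :=
  ∀ x : α, (∃ y : α, y < x) →
    ({v : α | v ≤ x}.Finite ∧
      ∃ f : {v : α // v ≤ x} → {v : α // v ≤ x}, IsSpecialMatching f)

/-- The degree of `v` in the Bruhat graph of the interval `[u,w]`: the number of `y ∈ [u,w]`
such that `v⁻¹ * y` is a reflection. -/
noncomputable def bruhatDeg (cs : CoxeterSystem M W) (u w v : W) : ℕ :=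
  Nat.card {y : W // (BruhatLE cs u y ∧ BruhatLE cs y w) ∧ cs.IsReflection (v⁻¹ * y)}

/-- A Bruhat interval `[u,w]` is rationally smooth if `deg_{y,w}(y) = ℓ(w) - ℓ(y)` for all
`y ∈ [u,w]` (Carrell–Peterson). -/
def RationallySmooth (cs : CoxeterSystem M W) (u w : W) : Prop :=
  ∀ y : W, BruhatLE cs u y → BruhatLE cs y w →
    bruhatDeg cs y w y = cs.length w - cs.length y


/-! ### The geometric representation -/

/-- The entry of the symmetric Cartan matrix attached to a bond of order `m`. -/
noncomputable def cartanEntry : ℕ → ℝ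
  | 1 => 2
  | 2 => 0
  | 3 => -1
  | 4 => -√2
  | 6 => -√3
  | _ => 0

/-- The coroot of the simple root indexed by `i`. -/
noncomputable def simpleCoroot (M : CoxeterMatrix B) (i : B) : Module.Dual ℝ (B →₀ ℝ) :=
  Finsupp.linearCombination ℝ fun j => cartanEntry (M i j)

theorem simpleCoroot_single (M : CoxeterMatrix B) (i j : B) :
    simpleCoroot M i (Finsupp.single j 1) = cartanEntry (M i j) := by
  simp [simpleCoroot]

theorem simpleCoroot_self (M : CoxeterMatrix B) (i : B) :
    simpleCoroot M i (Finsupp.single i 1) = 2 := by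
  simp [simpleCoroot_single, cartanEntry]

/-- All bonds between distinct vertices have order `2`, `3`, `4` or `6`. -/
def IsCrystallographic (M : CoxeterMatrix B) : Prop :=
  ∀ i j : B, i ≠ j → M i j ∈ ({2, 3, 4, 6} : Set ℕ)

theorem isLiftable_reflection (hM : IsCrystallographic M) :
    M.IsLiftable fun i => Module.reflection (simpleCoroot_self M i) := by
  intro i j
  by_cases hij : i = j
  · subst hij
    rw [M.diagonal, pow_one]
    ext1 z
    simp only [LinearEquiv.mul_apply, LinearEquiv.coe_one, id]
    exact Module.involutive_reflection _ z
  · ext1 z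
    rw [Module.reflection_mul_reflection_pow_apply _ _ (M i j) z
      (cartanEntry (M i j) * cartanEntry (M i j) - 2)
      (by simp only [simpleCoroot_single, M.symmetric j i])]
    simp only [simpleCoroot_single, M.symmetric j i]
    have h := hM i j hij
    simp only [Set.mem_insert_iff, Set.mem_singleton_iff] at h
    have e1 : (Polynomial.Chebyshev.S ℝ 2) = Polynomial.X ^ 2 - 1 := Polynomial.Chebyshev.S_two ℝ
    rcases h with h | h | h | h <;> rw [h] <;>
      norm_num [cartanEntry, Polynomial.Chebyshev.S_one, Polynomial.Chebyshev.S_zero, e1]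
    abel

/-- The geometric representation of a crystallographic Coxeter group. -/
noncomputable def geomRep (cs : CoxeterSystem M W) (hM : IsCrystallographic M) :
    W →* ((B →₀ ℝ) ≃ₗ[ℝ] (B →₀ ℝ)) :=
  cs.lift ⟨_, isLiftable_reflection hM⟩

section GeomRep

variable (cs : CoxeterSystem M W) (hM : IsCrystallographic M)

theorem geomRep_simple (i : B) (x : B →₀ ℝ) :
    geomRep cs hM (cs.simple i) x = x - simpleCoroot M i x • Finsupp.single i 1 := by
  rw [geomRep, cs.lift_apply_simple, Module.reflection_apply]

/-- The sequence of coefficients of the roots of a dihedral root system. -/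
noncomputable def dihedralCoeff (c : ℝ) : ℕ → ℝ
  | 0 => 0
  | 1 => 1
  | n + 2 => -c * dihedralCoeff c (n + 1) - dihedralCoeff c n

theorem dihedralCoeff_nonneg {m : ℕ} (hm : m ∈ ({2, 3, 4, 6} : Set ℕ)) {k : ℕ} (hk : k ≤ m) :
    0 ≤ dihedralCoeff (cartanEntry m) k := by
  have h2 : √2 * √2 = (2 : ℝ) := Real.mul_self_sqrt (by norm_num)
  have h3 : √3 * √3 = (3 : ℝ) := Real.mul_self_sqrt (by norm_num)
  have h2' := Real.sqrt_nonneg 2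
  have h3' := Real.sqrt_nonneg 3
  simp only [Set.mem_insert_iff, Set.mem_singleton_iff] at hm
  rcases hm with rfl | rfl | rfl | rfl <;> interval_cases k <;>
    norm_num [dihedralCoeff, cartanEntry, h2, h3] <;> nlinarith

theorem geomRep_alternatingWord_single {i j : B} (k : ℕ) :
    geomRep cs hM (cs.wordProd (CoxeterSystem.alternatingWord i j k)) (Finsupp.single i 1) =
      if Even k then
        dihedralCoeff (cartanEntry (M i j)) (k + 1) • Finsupp.single i 1 +
          dihedralCoeff (cartanEntry (M i j)) k • Finsupp.single j 1
      else
        dihedralCoeff (cartanEntry (M i j)) k • Finsupp.single i 1 +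
          dihedralCoeff (cartanEntry (M i j)) (k + 1) • Finsupp.single j 1 := by
  induction k with
  | zero => simp [CoxeterSystem.alternatingWord, dihedralCoeff]
  | succ k ih =>
    rw [CoxeterSystem.alternatingWord_succ', cs.wordProd_cons, map_mul, LinearEquiv.mul_apply, ih]
    by_cases hk : Even k
    · have hk' : ¬ Even (k + 1) := by simpa [Nat.even_add_one] using hk
      simp only [hk, hk', if_true, if_false, geomRep_simple, map_add, map_smul,
        simpleCoroot_single, M.symmetric j i, M.diagonal]
      rw [dihedralCoeff]
      simp only [cartanEntry]
      module
    · have hk' : Even (k + 1) := by simpa [Nat.even_add_one] using hk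
      simp only [hk, hk', if_true, if_false, geomRep_simple, map_add, map_smul,
        simpleCoroot_single, M.diagonal]
      rw [dihedralCoeff]
      simp only [cartanEntry]
      module

theorem geomRep_single_nonneg (w : W) (i : B) (hi : ¬ cs.IsRightDescent w i) :
    0 ≤ geomRep cs hM w (Finsupp.single i 1) := by
  induction hn : cs.length w using Nat.strong_induction_on generalizing w i with
  | _ n ih =>
  subst hn
  by_cases hw : w = 1
  · subst hw
    simp
  obtain ⟨j, hj⟩ := cs.exists_rightDescent_of_ne_one hw
  have hij : i ≠ j := by rintro rfl; exact hi hj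
  have hMij := hM i j hij
  have key : ∀ d k : ℕ, k + d = M i j → 1 ≤ k → ∀ v : W,
      w = v * cs.wordProd (CoxeterSystem.alternatingWord i j k) →
      cs.length v + k = cs.length w → 0 ≤ geomRep cs hM w (Finsupp.single i 1) := by
    intro d
    induction d with
    | zero =>
      intro k hk hk1 v hv hl
      exfalso
      obtain ⟨k, rfl⟩ : ∃ k', k = k' + 1 := ⟨k - 1, by omega⟩
      have e : cs.wordProd (CoxeterSystem.alternatingWord i j (k + 1)) =
          cs.wordProd (CoxeterSystem.alternatingWord i j k) * cs.simple i := by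
        have h := cs.wordProd_braidWord_eq i j
        rw [CoxeterSystem.braidWord, CoxeterSystem.braidWord, M.symmetric j i] at h
        rw [add_zero] at hk
        rw [hk, h, ← hk, CoxeterSystem.alternatingWord_succ, cs.wordProd_concat]
      apply hi
      rw [CoxeterSystem.IsRightDescent]
      nth_rw 1 [hv]
      rw [e, ← mul_assoc, cs.simple_mul_simple_cancel_right]
      have h1 := cs.length_mul_le v (cs.wordProd (CoxeterSystem.alternatingWord i j k))
      have h2 := cs.length_wordProd_le (CoxeterSystem.alternatingWord i j k)
      rw [CoxeterSystem.length_alternatingWord] at h2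
      omega
    | succ d ihd =>
      intro k hk hk1 v hv hl
      obtain ⟨k, rfl⟩ : ∃ k', k = k' + 1 := ⟨k - 1, by omega⟩
      by_cases hx : cs.IsRightDescent v (if Even (k + 1) then j else i)
      · refine ihd (k + 1 + 1) (by omega) (by omega)
          (v * cs.simple (if Even (k + 1) then j else i)) ?_ ?_
        · rw [CoxeterSystem.alternatingWord_succ' i j (k + 1), cs.wordProd_cons, ← mul_assoc,
            cs.simple_mul_simple_cancel_right, ← hv]
        · have := cs.isRightDescent_iff.1 hx
          omega
      · have hy : ¬ cs.IsRightDescent v (if Even k then j else i) := by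
          rw [cs.not_isRightDescent_iff]
          rw [CoxeterSystem.alternatingWord_succ', cs.wordProd_cons, ← mul_assoc] at hv
          have h1 := cs.length_mul_le (v * cs.simple (if Even k then j else i))
            (cs.wordProd (CoxeterSystem.alternatingWord i j k))
          have h2 := cs.length_wordProd_le (CoxeterSystem.alternatingWord i j k)
          rw [CoxeterSystem.length_alternatingWord] at h2
          rw [← hv] at h1
          rcases cs.length_mul_simple v (if Even k then j else i) with h | h <;> omega
        have hvi : ¬ cs.IsRightDescent v i ∧ ¬ cs.IsRightDescent v j := by
          by_cases he : Even k
          · have he' : ¬ Even (k + 1) := by simpa [Nat.even_add_one] using he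
            simp only [he, he', if_true, if_false] at hx hy
            exact ⟨hx, hy⟩
          · have he' : Even (k + 1) := by simpa [Nat.even_add_one] using he
            simp only [he, he', if_true, if_false] at hx hy
            exact ⟨hy, hx⟩
        have pi := ih _ (by omega) v i hvi.1 rfl
        have pj := ih _ (by omega) v j hvi.2 rfl
        have c1 := dihedralCoeff_nonneg hMij (k := k + 1) (by omega)
        have c2 := dihedralCoeff_nonneg hMij (k := k + 1 + 1) (by omega)
        rw [hv, map_mul, LinearEquiv.mul_apply, geomRep_alternatingWord_single]
        split_ifs <;> rw [map_add, map_smul, map_smul] <;>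
          exact add_nonneg (smul_nonneg (by assumption) (by assumption))
            (smul_nonneg (by assumption) (by assumption))
  have hj' := cs.isRightDescent_iff.1 hj
  have hM1 : 1 ≤ M i j := by
    simp only [Set.mem_insert_iff, Set.mem_singleton_iff] at hMij
    omega
  refine key (M i j - 1) 1 (by omega) le_rfl (w * cs.simple j) ?_ (by omega)
  simp [CoxeterSystem.alternatingWord]

theorem geomRep_inv_apply_self (w : W) (x : B →₀ ℝ) :
    geomRep cs hM w⁻¹ (geomRep cs hM w x) = x := by
  rw [← LinearEquiv.mul_apply, ← map_mul, inv_mul_cancel, map_one, LinearEquiv.coe_one, id]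

theorem geomRep_apply_inv_self (w : W) (x : B →₀ ℝ) :
    geomRep cs hM w (geomRep cs hM w⁻¹ x) = x := by
  rw [← LinearEquiv.mul_apply, ← map_mul, mul_inv_cancel, map_one, LinearEquiv.coe_one, id]

theorem geomRep_simple_single (i : B) :
    geomRep cs hM (cs.simple i) (Finsupp.single i 1) = -Finsupp.single i 1 := by
  rw [geomRep_simple, simpleCoroot_self]
  module

theorem geomRep_injective : Function.Injective (geomRep cs hM) := by
  rw [injective_iff_map_eq_one]
  intro w hw
  by_contra hne
  obtain ⟨i, hi⟩ := cs.exists_rightDescent_of_ne_one hne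
  have h := geomRep_single_nonneg cs hM (w * cs.simple i) i
    (cs.isRightDescent_iff_not_isRightDescent_mul.1 hi)
  rw [map_mul, hw, one_mul, geomRep_simple_single] at h
  have := h i
  simp at this
  linarith

/-- `β` is a root of the reflection `t`. -/
def IsRoot (t : W) (β : B →₀ ℝ) : Prop :=
  ∃ w i, t = w * cs.simple i * w⁻¹ ∧ β = geomRep cs hM w (Finsupp.single i 1)

variable {cs hM}

theorem IsRoot.isReflection {t : W} {β : B →₀ ℝ} (h : IsRoot cs hM t β) : cs.IsReflection t := by
  obtain ⟨w, i, rfl, -⟩ := h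
  exact ⟨w, i, rfl⟩

theorem isRoot_simple (i : B) : IsRoot cs hM (cs.simple i) (Finsupp.single i 1) :=
  ⟨1, i, by simp, by simp⟩

theorem IsRoot.conj {t : W} {β : B →₀ ℝ} (h : IsRoot cs hM t β) (g : W) :
    IsRoot cs hM (g * t * g⁻¹) (geomRep cs hM g β) := by
  obtain ⟨w, i, rfl, rfl⟩ := h
  exact ⟨g * w, i, by group, by rw [map_mul, LinearEquiv.mul_apply]⟩

theorem IsRoot.neg {t : W} {β : B →₀ ℝ} (h : IsRoot cs hM t β) : IsRoot cs hM t (-β) := by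
  obtain ⟨w, i, rfl, rfl⟩ := h
  refine ⟨w * cs.simple i, i, by simp [mul_assoc], ?_⟩
  rw [map_mul, LinearEquiv.mul_apply, geomRep_simple_single, map_neg]

theorem IsRoot.ne_zero {t : W} {β : B →₀ ℝ} (h : IsRoot cs hM t β) : β ≠ 0 := by
  obtain ⟨w, i, rfl, rfl⟩ := h
  simp

theorem IsRoot.nonneg_or_nonpos {t : W} {β : B →₀ ℝ} (h : IsRoot cs hM t β) : 0 ≤ β ∨ β ≤ 0 := by
  obtain ⟨w, i, rfl, rfl⟩ := h
  by_cases hd : cs.IsRightDescent w i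
  · right
    have h := geomRep_single_nonneg cs hM (w * cs.simple i) i
      (cs.isRightDescent_iff_not_isRightDescent_mul.1 hd)
    rw [map_mul, LinearEquiv.mul_apply, geomRep_simple_single, map_neg] at h
    exact neg_nonneg.1 h
  · exact Or.inl (geomRep_single_nonneg cs hM w i hd)

theorem exists_nonneg_root (hM : IsCrystallographic M) {t : W} (ht : cs.IsReflection t) :
    ∃ β, IsRoot cs hM t β ∧ 0 ≤ β := by
  obtain ⟨w, i, rfl⟩ := ht
  have h : IsRoot cs hM (w * cs.simple i * w⁻¹) (geomRep cs hM w (Finsupp.single i 1)) :=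
    ⟨w, i, rfl, rfl⟩
  rcases h.nonneg_or_nonpos with h' | h'
  · exact ⟨_, h, h'⟩
  · exact ⟨_, h.neg, neg_nonneg.2 h'⟩

theorem IsRoot.exists_coroot {t : W} {β : B →₀ ℝ} (h : IsRoot cs hM t β) :
    ∃ f : Module.Dual ℝ (B →₀ ℝ), f β = 2 ∧ ∀ x, geomRep cs hM t x = x - f x • β := by
  obtain ⟨w, i, rfl, rfl⟩ := h
  refine ⟨simpleCoroot M i ∘ₗ (geomRep cs hM w⁻¹).toLinearMap, ?_, fun x => ?_⟩
  · simp only [LinearMap.comp_apply, LinearEquiv.coe_coe]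
    rw [geomRep_inv_apply_self, simpleCoroot_self]
  · simp only [LinearMap.comp_apply, LinearEquiv.coe_coe]
    rw [map_mul, map_mul, LinearEquiv.mul_apply, LinearEquiv.mul_apply, geomRep_simple, map_sub,
      map_smul, geomRep_apply_inv_self]

theorem IsRoot.apply_self {t : W} {β : B →₀ ℝ} (h : IsRoot cs hM t β) :
    geomRep cs hM t β = -β := by
  obtain ⟨f, hf, h⟩ := h.exists_coroot
  rw [h, hf]
  module

theorem IsRoot.eq_smul {t : W} {β γ : B →₀ ℝ} (hβ : IsRoot cs hM t β) (hγ : IsRoot cs hM t γ) :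
    ∃ c : ℝ, γ = c • β := by
  obtain ⟨f, hf, h⟩ := hβ.exists_coroot
  refine ⟨f γ / 2, ?_⟩
  have h1 := h γ
  rw [hγ.apply_self] at h1
  have h2 : (2 : ℝ) • γ = f γ • β := by
    rw [two_smul]
    calc γ + γ = γ - -γ := by abel
      _ = γ - (γ - f γ • β) := by rw [h1]
      _ = _ := by abel
  calc γ = (1 / 2 : ℝ) • (2 : ℝ) • γ := by rw [smul_smul]; norm_num
    _ = _ := by rw [h2, smul_smul]; congr 1; ring

theorem simple_injective (hM : IsCrystallographic M) : Function.Injective cs.simple := by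
  intro i j hij
  have h1 := isRoot_simple (cs := cs) (hM := hM) i
  have h2 := isRoot_simple (cs := cs) (hM := hM) j
  rw [hij] at h1
  obtain ⟨c, hc⟩ := h1.eq_smul h2
  by_contra hne
  have := DFunLike.congr_fun hc j
  simp [hne] at this

variable (cs hM) in
theorem exists_invariant_form [Finite W] :
    ∃ Q : (B →₀ ℝ) →ₗ[ℝ] (B →₀ ℝ) →ₗ[ℝ] ℝ, (∀ x y, Q x y = Q y x) ∧ (∀ x, x ≠ 0 → 0 < Q x x) ∧
      ∀ w x y, Q (geomRep cs hM w x) (geomRep cs hM w y) = Q x y := by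
  have := Fintype.ofFinite W
  let d : (B →₀ ℝ) →ₗ[ℝ] (B →₀ ℝ) →ₗ[ℝ] ℝ :=
    Finsupp.linearCombination ℝ fun j => Finsupp.lapply j
  have hd : ∀ x y, d x y = x.sum fun j a => a * y j := by
    intro x y
    simp [d, Finsupp.linearCombination_apply, Finsupp.sum, LinearMap.sum_apply]
  have hsymm : ∀ x y, d x y = d y x := by
    classical
    intro x y
    rw [hd, hd, Finsupp.sum_of_support_subset x (Finset.subset_union_left (s₂ := y.support)) _
      (by simp), Finsupp.sum_of_support_subset y (Finset.subset_union_right (s₁ := x.support)) _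
      (by simp)]
    exact Finset.sum_congr rfl fun _ _ => mul_comm _ _
  have hpos : ∀ x, x ≠ 0 → 0 < d x x := by
    intro x hx
    rw [hd]
    refine Finset.sum_pos (fun j hj => ?_) (Finsupp.support_nonempty_iff.2 hx)
    exact mul_self_pos.2 (Finsupp.mem_support_iff.1 hj)
  refine ⟨∑ w : W, d.compl₁₂ (geomRep cs hM w).toLinearMap (geomRep cs hM w).toLinearMap,
    fun x y => ?_, fun x hx => ?_, fun w x y => ?_⟩
  · simp only [LinearMap.sum_apply, LinearMap.compl₁₂_apply]
    exact Finset.sum_congr rfl fun _ _ => hsymm _ _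
  · simp only [LinearMap.sum_apply, LinearMap.compl₁₂_apply]
    refine Finset.sum_pos (fun w _ => hpos _ ?_) Finset.univ_nonempty
    simpa using hx
  · simp only [LinearMap.sum_apply, LinearMap.compl₁₂_apply, LinearEquiv.coe_coe]
    refine Fintype.sum_equiv (Equiv.mulRight w) _ _ fun v => ?_
    rw [Equiv.coe_mulRight, map_mul, LinearEquiv.mul_apply, LinearEquiv.mul_apply]

/-- A positive definite bilinear form invariant under the geometric representation. -/
structure IsInvariantForm (cs : CoxeterSystem M W) (hM : IsCrystallographic M)
    (Q : (B →₀ ℝ) →ₗ[ℝ] (B →₀ ℝ) →ₗ[ℝ] ℝ) : Prop where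
  symm : ∀ x y, Q x y = Q y x
  pos : ∀ x, x ≠ 0 → 0 < Q x x
  inv : ∀ w x y, Q (geomRep cs hM w x) (geomRep cs hM w y) = Q x y

variable {Q : (B →₀ ℝ) →ₗ[ℝ] (B →₀ ℝ) →ₗ[ℝ] ℝ}

theorem IsInvariantForm.apply_reflection (hQ : IsInvariantForm cs hM Q) {t : W} {β : B →₀ ℝ}
    (h : IsRoot cs hM t β) (x : B →₀ ℝ) :
    geomRep cs hM t x = x - (2 * Q x β / Q β β) • β := by
  obtain ⟨f, hf, h'⟩ := h.exists_coroot
  have h1 := hQ.inv t x β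
  have h0 := hQ.pos β h.ne_zero
  rw [h.apply_self, h', map_sub, map_smul, LinearMap.sub_apply, LinearMap.smul_apply, map_neg,
    map_neg, smul_eq_mul] at h1
  rw [h']
  congr 2
  field_simp
  linarith

theorem IsRoot.eq_of_eq_smul [Finite W] {t t' : W} {β : B →₀ ℝ} {c : ℝ}
    (h : IsRoot cs hM t β) (h' : IsRoot cs hM t' (c • β)) : t = t' := by
  obtain ⟨Q, hQ1, hQ2, hQ3⟩ := exists_invariant_form cs hM
  have hQ : IsInvariantForm cs hM Q := ⟨hQ1, hQ2, hQ3⟩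
  apply geomRep_injective cs hM
  ext1 x
  have hc : c ≠ 0 := fun hc => h'.ne_zero (by simp [hc])
  have h0 := hQ.pos β h.ne_zero
  rw [hQ.apply_reflection h, hQ.apply_reflection h', smul_smul]
  congr 2
  simp only [map_smul, LinearMap.smul_apply, smul_eq_mul]
  field_simp

theorem IsRoot.simple_apply_nonneg [Finite W] {t : W} {β : B →₀ ℝ} (h : IsRoot cs hM t β)
    (hβ : 0 ≤ β) {i : B} (hi : t ≠ cs.simple i) : 0 ≤ geomRep cs hM (cs.simple i) β := by
  rcases (h.conj (cs.simple i)).nonneg_or_nonpos with h' | h'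
  · exact h'
  · exfalso
    have e : β = β i • Finsupp.single i 1 := by
      ext j
      by_cases hj : i = j
      · subst hj
        simp
      · have h1 := h' j
        have h2 := hβ j
        rw [geomRep_simple] at h1
        simp [hj] at h1 h2 ⊢
        exact le_antisymm h1 h2
    rw [e] at h
    exact hi ((isRoot_simple i).eq_of_eq_smul h).symm

theorem IsRoot.length_mul_lt [Finite W] {t : W} {β : B →₀ ℝ} (h : IsRoot cs hM t β)
    (hβ : 0 ≤ β) {x : W} (hx : ¬ 0 ≤ geomRep cs hM x⁻¹ β) : cs.length (t * x) < cs.length x := by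
  induction hn : cs.length x generalizing x t β with
  | zero =>
    rw [cs.length_eq_zero_iff] at hn
    subst hn
    simp [hβ] at hx
  | succ n ih =>
    have hx1 : x ≠ 1 := by
      rintro rfl
      simp at hn
    obtain ⟨i, hi⟩ := cs.exists_leftDescent_of_ne_one hx1
    rw [cs.isLeftDescent_iff] at hi
    by_cases hti : t = cs.simple i
    · subst hti
      omega
    · have h1 := ih (h.conj (cs.simple i)) (h.simple_apply_nonneg hβ hti)
        (x := cs.simple i * x) (by
          rw [mul_inv_rev, map_mul, LinearEquiv.mul_apply, geomRep_inv_apply_self]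
          exact hx) (by omega)
      have h2 : t * x = cs.simple i * (cs.simple i * t * (cs.simple i)⁻¹ * (cs.simple i * x)) := by
        simp [mul_assoc]
      rw [h2]
      rcases cs.length_simple_mul (cs.simple i * t * (cs.simple i)⁻¹ * (cs.simple i * x)) i with
        h | h <;> omega

theorem IsRoot.length_lt_iff [Finite W] {t : W} {β : B →₀ ℝ} (h : IsRoot cs hM t β)
    (hβ : 0 ≤ β) {x : W} : cs.length x < cs.length (t * x) ↔ 0 ≤ geomRep cs hM x⁻¹ β := by
  constructor
  · intro hl
    by_contra hx
    exact absurd (h.length_mul_lt hβ hx) hl.asymm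
  · intro hx
    have h1 := h.length_mul_lt hβ (x := t * x) (by
      rw [mul_inv_rev, h.isReflection.inv, map_mul, LinearEquiv.mul_apply, h.apply_self, map_neg]
      intro h2
      have h3 := le_antisymm hx (neg_nonneg.1 h2)
      exact h.ne_zero ((LinearEquiv.map_eq_zero_iff _).1 h3.symm))
    rwa [← mul_assoc, h.isReflection.mul_self, one_mul] at h1

theorem BruhatStep.mul_simple [Finite W] (hM : IsCrystallographic M) {x y : W}
    (h : BruhatStep cs x y) {i : B} (hne : x * cs.simple i ≠ y) :
    BruhatStep cs (x * cs.simple i) (y * cs.simple i) := by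
  obtain ⟨t, ht, rfl, hl⟩ := h
  refine ⟨t, ht, mul_assoc _ _ _, ?_⟩
  obtain ⟨β, hβ, hβ0⟩ := exists_nonneg_root hM ht
  rw [hβ.length_lt_iff hβ0] at hl
  rw [mul_assoc, hβ.length_lt_iff hβ0, mul_inv_rev, map_mul, LinearEquiv.mul_apply, cs.inv_simple]
  refine (hβ.conj x⁻¹).simple_apply_nonneg hl fun h => hne ?_
  rw [← h]
  group

variable (cs hM) in
/-- The nonnegative roots lying in a subspace. -/
def positiveRootsIn (P : Submodule ℝ (B →₀ ℝ)) : Set (B →₀ ℝ) :=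
  {γ | (∃ t, IsRoot cs hM t γ) ∧ 0 ≤ γ ∧ γ ∈ P}

theorem finite_positiveRootsIn [Finite W] (P : Submodule ℝ (B →₀ ℝ)) :
    (positiveRootsIn cs hM P).Finite := by
  have : Finite B := Finite.of_injective _ (simple_injective (cs := cs) hM)
  refine (Set.finite_range fun p : W × B =>
    geomRep cs hM p.1 (Finsupp.single p.2 1)).subset ?_
  rintro γ ⟨⟨t, w, i, -, rfl⟩, -, -⟩
  exact ⟨(w, i), rfl⟩

/-- The sum of the coordinates. -/
noncomputable def height : (B →₀ ℝ) →ₗ[ℝ] ℝ := Finsupp.linearCombination ℝ fun _ => (1 : ℝ)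

theorem height_pos {x : B →₀ ℝ} (hx : 0 ≤ x) (h0 : x ≠ 0) : 0 < height x := by
  rw [height, Finsupp.linearCombination_apply]
  refine Finset.sum_pos (fun j hj => ?_) (Finsupp.support_nonempty_iff.2 h0)
  simpa using lt_of_le_of_ne (hx j) (Ne.symm (Finsupp.mem_support_iff.1 hj))

/-- The positive roots in a plane spanned by two roots have two extremal rays. -/
theorem exists_extremal_roots [Finite W] {t t' : W} {β β' : B →₀ ℝ} (hβ : IsRoot cs hM t β)
    (hβ' : IsRoot cs hM t' β') (hβ0 : 0 ≤ β) (hβ0' : 0 ≤ β') (hne : t ≠ t') :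
    ∃ β₁ ∈ positiveRootsIn cs hM (Submodule.span ℝ {β, β'}),
    ∃ β₂ ∈ positiveRootsIn cs hM (Submodule.span ℝ {β, β'}),
    ∃ ψ₁ ψ₂ : Module.Dual ℝ (B →₀ ℝ),
      (∀ γ ∈ positiveRootsIn cs hM (Submodule.span ℝ {β, β'}), 0 ≤ ψ₁ γ ∧ 0 ≤ ψ₂ γ) ∧
      ψ₁ β₁ = 0 ∧ 0 < ψ₁ β₂ ∧ ψ₂ β₂ = 0 ∧ 0 < ψ₂ β₁ ∧
      ∀ x ∈ Submodule.span ℝ {β, β'}, ψ₁ x = 0 → ψ₂ x = 0 → x = 0 := by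
  have hh := height_pos hβ0 hβ.ne_zero
  have hh' := height_pos hβ0' hβ'.ne_zero
  obtain ⟨j, hj⟩ : ∃ j, β j * height β' - β' j * height β ≠ 0 := by
    by_contra! hcon
    have e : β' = (height β' / height β) • β := by
      ext j
      have := hcon j
      rw [Finsupp.smul_apply, smul_eq_mul]
      field_simp
      linarith
    rw [e] at hβ'
    exact hne (hβ.eq_of_eq_smul hβ')
  set P := Submodule.span ℝ {β, β'} with hP
  have hmem : β ∈ positiveRootsIn cs hM P := ⟨⟨t, hβ⟩, hβ0, Submodule.subset_span (by simp)⟩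
  have hmem' : β' ∈ positiveRootsIn cs hM P := ⟨⟨t', hβ'⟩, hβ0', Submodule.subset_span (by simp)⟩
  have hpos : ∀ γ ∈ positiveRootsIn cs hM P, 0 < height γ := by
    rintro γ ⟨⟨t, h⟩, h0, -⟩
    exact height_pos h0 h.ne_zero
  obtain ⟨β₁, h1, h1max⟩ := Set.exists_max_image _ (fun γ => γ j / height γ)
    (finite_positiveRootsIn (cs := cs) (hM := hM) P) ⟨β, hmem⟩
  obtain ⟨β₂, h2, h2min⟩ := Set.exists_min_image _ (fun γ => γ j / height γ)
    (finite_positiveRootsIn (cs := cs) (hM := hM) P) ⟨β, hmem⟩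
  have hlt : β₂ j / height β₂ < β₁ j / height β₁ := by
    refine lt_of_le_of_ne (h1max _ h2) fun heq => hj ?_
    have e1 : β j / height β = β₁ j / height β₁ :=
      le_antisymm (h1max _ hmem) (heq ▸ h2min _ hmem)
    have e2 : β' j / height β' = β₁ j / height β₁ :=
      le_antisymm (h1max _ hmem') (heq ▸ h2min _ hmem')
    rw [← e2, div_eq_div_iff hh.ne' hh'.ne'] at e1
    linarith
  set a := β₁ j / height β₁ with ha
  set b := β₂ j / height β₂ with hb
  have hp1 := hpos _ h1
  have hp2 := hpos _ h2
  have ea : β₁ j = a * height β₁ := by rw [ha]; field_simp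
  have eb : β₂ j = b * height β₂ := by rw [hb]; field_simp
  refine ⟨β₁, h1, β₂, h2, a • height - Finsupp.lapply j, Finsupp.lapply j - b • height,
    fun γ hγ => ⟨?_, ?_⟩, ?_, ?_, ?_, ?_, fun x hx hx1 hx2 => ?_⟩
  · have h3 := h1max γ hγ
    have h4 := hpos _ hγ
    rw [div_le_iff₀ h4] at h3
    simpa using h3
  · have h3 := h2min γ hγ
    have h4 := hpos _ hγ
    rw [le_div_iff₀ h4] at h3
    simpa using h3
  · simp [ea]
  · simp only [LinearMap.sub_apply, LinearMap.smul_apply, smul_eq_mul, Finsupp.lapply_apply, eb]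
    nlinarith
  · simp [eb]
  · simp only [LinearMap.sub_apply, LinearMap.smul_apply, smul_eq_mul, Finsupp.lapply_apply, ea]
    nlinarith
  · simp only [LinearMap.sub_apply, LinearMap.smul_apply, smul_eq_mul,
      Finsupp.lapply_apply] at hx1 hx2
    have hx3 : height x = 0 := by
      have : (a - b) * height x = 0 := by linarith
      exact (mul_eq_zero.1 this).resolve_left (sub_pos.2 hlt).ne'
    have hx4 : x j = 0 := by
      rw [hx3] at hx1
      linarith
    obtain ⟨p, q, rfl⟩ := Submodule.mem_span_pair.1 hx
    simp only [map_add, map_smul, smul_eq_mul, Finsupp.add_apply, Finsupp.smul_apply] at hx3 hx4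
    have hp : p = 0 := by
      have : p * (β j * height β' - β' j * height β) = 0 := by
        linear_combination height β' * hx4 - β' j * hx3
      exact (mul_eq_zero.1 this).resolve_right hj
    have hq : q = 0 := by
      have : q * (β j * height β' - β' j * height β) = 0 := by
        linear_combination β j * hx3 - height β * hx4
      exact (mul_eq_zero.1 this).resolve_right hj
    simp [hp, hq]

/-- Reducing a positive root of a plane by an extremal one. -/
theorem reflect_mem_positiveRootsIn [Finite W] {P : Submodule ℝ (B →₀ ℝ)} {r t : W}
    {β γ : B →₀ ℝ} (hr : IsRoot cs hM r β) (hβ : β ∈ P) (hβ0 : 0 ≤ β) (ht : IsRoot cs hM t γ)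
    (hγ : γ ∈ P) (hQ : IsInvariantForm cs hM Q) (hpos : 0 < Q γ β)
    {ψ : Module.Dual ℝ (B →₀ ℝ)} (hψ : ∀ δ ∈ positiveRootsIn cs hM P, 0 ≤ ψ δ)
    (hψβ : ψ β = 0) (hψγ : 0 < ψ γ) :
    ∃ δ ∈ positiveRootsIn cs hM P, IsRoot cs hM (r * t * r⁻¹) δ ∧ height δ < height γ := by
  have hc := ht.conj r
  have e := hQ.apply_reflection hr γ
  have hβ2 := hQ.pos β hr.ne_zero
  have hcoef : 0 < 2 * Q γ β / Q β β := by positivity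
  have hP : geomRep cs hM r γ ∈ P := by
    rw [e]
    exact P.sub_mem hγ (P.smul_mem _ hβ)
  refine ⟨_, ⟨⟨_, hc⟩, ?_, hP⟩, hc, ?_⟩
  · rcases hc.nonneg_or_nonpos with h | h
    · exact h
    · have := hψ _ ⟨⟨_, hc.neg⟩, neg_nonneg.2 h, P.neg_mem hP⟩
      rw [e, map_neg, map_sub, map_smul, hψβ, smul_zero, sub_zero] at this
      linarith
  · rw [e, map_sub, map_smul, smul_eq_mul]
    have := mul_pos hcoef (height_pos hβ0 hr.ne_zero)
    linarith

/-- The elements `(r₁ r₂) ^ k * r₁` of the dihedral group generated by two involutions. -/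
def dihedralOdd (r₁ r₂ : W) : Set W := {g | ∃ k : ℤ, g = (r₁ * r₂) ^ k * r₁}

theorem mul_zpow_mul_self {r₁ r₂ : W} (h1 : r₁ * r₁ = 1) (h2 : r₂ * r₂ = 1) (k : ℤ) :
    r₁ * (r₁ * r₂) ^ k = (r₁ * r₂) ^ (-k) * r₁ := by
  have e1 : r₁⁻¹ = r₁ := inv_eq_of_mul_eq_one_left h1
  have e2 : r₂⁻¹ = r₂ := inv_eq_of_mul_eq_one_left h2
  have h3 : r₁ * (r₁ * r₂) * r₁⁻¹ = (r₁ * r₂)⁻¹ := by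
    rw [mul_inv_rev, e1, e2, ← mul_assoc, h1, one_mul]
  have h4 : r₁ * (r₁ * r₂) ^ k * r₁⁻¹ = (r₁ * r₂) ^ (-k) := by
    rw [← conj_zpow, h3, inv_zpow, zpow_neg]
  rw [← h4, inv_mul_cancel_right]

theorem dihedralOdd_mul_mul {r₁ r₂ : W} (h1 : r₁ * r₁ = 1) (h2 : r₂ * r₂ = 1) {a b c : W}
    (ha : a ∈ dihedralOdd r₁ r₂) (hb : b ∈ dihedralOdd r₁ r₂) (hc : c ∈ dihedralOdd r₁ r₂) :
    a * b * c ∈ dihedralOdd r₁ r₂ := by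
  obtain ⟨k, rfl⟩ := ha
  obtain ⟨l, rfl⟩ := hb
  obtain ⟨m, rfl⟩ := hc
  refine ⟨k - l + m, ?_⟩
  have e : (r₁ * r₂) ^ k * r₁ * ((r₁ * r₂) ^ l * r₁) * ((r₁ * r₂) ^ m * r₁) =
      (r₁ * r₂) ^ k * (r₁ * (r₁ * r₂) ^ l) * r₁ * (r₁ * r₂) ^ m * r₁ := by group
  rw [e, mul_zpow_mul_self h1 h2, zpow_add, zpow_sub, zpow_neg]
  simp only [mul_assoc]
  rw [← mul_assoc r₁ r₁, h1, one_mul]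

theorem left_mem_dihedralOdd (r₁ r₂ : W) : r₁ ∈ dihedralOdd r₁ r₂ := ⟨0, by simp⟩

theorem right_mem_dihedralOdd {r₁ r₂ : W} (h2 : r₂ * r₂ = 1) : r₂ ∈ dihedralOdd r₁ r₂ := by
  refine ⟨-1, ?_⟩
  rw [zpow_neg_one, mul_inv_rev, inv_mul_cancel_right, inv_eq_of_mul_eq_one_left h2]

theorem isReflection_of_mem_dihedralOdd {r₁ r₂ : W} (h1 : cs.IsReflection r₁)
    (h2 : cs.IsReflection r₂) {g : W} (hg : g ∈ dihedralOdd r₁ r₂) : cs.IsReflection g := by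
  obtain ⟨k, rfl⟩ := hg
  have e : ∀ m : ℤ, (r₁ * r₂) ^ m * r₁ * ((r₁ * r₂) ^ m)⁻¹ = (r₁ * r₂) ^ (m + m) * r₁ := by
    intro m
    rw [← zpow_neg, mul_assoc, mul_zpow_mul_self h1.mul_self h2.mul_self, neg_neg, zpow_add,
      mul_assoc]
  rcases Int.even_or_odd' k with ⟨m, rfl | rfl⟩
  · rw [two_mul, ← e]
    exact h1.conj _
  · have : (r₁ * r₂) ^ (2 * m + 1) * r₁ =
        (r₁ * r₂) ^ m * (r₁ * r₂ * r₁⁻¹) * ((r₁ * r₂) ^ m)⁻¹ := by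
      rw [h1.inv, mul_assoc _ (r₁ * r₂ * r₁), mul_assoc (r₁ * r₂), ← zpow_neg,
        mul_zpow_mul_self h1.mul_self h2.mul_self, neg_neg, two_mul, zpow_add, zpow_add, zpow_one]
      have hcomm := (Commute.self_zpow (r₁ * r₂) m).eq
      simp only [mul_assoc] at hcomm ⊢
      rw [← mul_assoc ((r₁ * r₂) ^ m) r₁, ← mul_assoc ((r₁ * r₂) ^ m * r₁)]
      have h' : r₁ * (r₂ * ((r₁ * r₂) ^ m * r₁)) = (r₁ * (r₂ * (r₁ * r₂) ^ m)) * r₁ := by group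
      rw [h', hcomm]
      group
    rw [this]
    exact (h2.conj r₁).conj _

/-- The reflections whose roots lie in a plane belong to a dihedral reflection subgroup. -/
theorem exists_dihedralOdd [Finite W] {t t' : W} {β β' : B →₀ ℝ} (hβ : IsRoot cs hM t β)
    (hβ' : IsRoot cs hM t' β') (hne : t ≠ t') :
    ∃ r₁ r₂, cs.IsReflection r₁ ∧ cs.IsReflection r₂ ∧
      ∀ s γ, IsRoot cs hM s γ → γ ∈ Submodule.span ℝ {β, β'} → s ∈ dihedralOdd r₁ r₂ := by
  wlog h0 : 0 ≤ β generalizing β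
  · have := this hβ.neg (neg_nonneg.2 (hβ.nonneg_or_nonpos.resolve_left h0))
    rwa [Submodule.span_insert, ← Set.neg_singleton, Submodule.span_neg,
      ← Submodule.span_insert] at this
  wlog h0' : 0 ≤ β' generalizing β'
  · have := this hβ'.neg (neg_nonneg.2 (hβ'.nonneg_or_nonpos.resolve_left h0'))
    rwa [Submodule.span_insert, ← Set.neg_singleton, Submodule.span_neg,
      ← Submodule.span_insert] at this
  obtain ⟨β₁, ⟨⟨r₁, h1⟩, h1n, h1P⟩, β₂, ⟨⟨r₂, h2⟩, h2n, h2P⟩, ψ₁, ψ₂, hψ, h11, h12, h22, h21,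
    hsep⟩ := exists_extremal_roots hβ hβ' h0 h0' hne
  set P := Submodule.span ℝ {β, β'} with hP
  refine ⟨r₁, r₂, h1.isReflection, h2.isReflection, ?_⟩
  obtain ⟨Q, hQ1, hQ2, hQ3⟩ := exists_invariant_form cs hM
  have hQ : IsInvariantForm cs hM Q := ⟨hQ1, hQ2, hQ3⟩
  have hr1 := h1.isReflection.mul_self
  have hr2 := h2.isReflection.mul_self
  have main : {γ | γ ∈ positiveRootsIn cs hM P ∧
      ∃ s, IsRoot cs hM s γ ∧ s ∉ dihedralOdd r₁ r₂} = ∅ := by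
    by_contra hcon
    obtain ⟨γ, ⟨hγ, s, hs, hsn⟩, hmin⟩ := Set.exists_min_image _ height
      ((finite_positiveRootsIn (cs := cs) (hM := hM) P).subset fun γ h => h.1)
      (Set.nonempty_iff_ne_empty.2 hcon)
    have reduce : ∀ r ∈ dihedralOdd r₁ r₂, ∀ δ ∈ positiveRootsIn cs hM P,
        IsRoot cs hM (r * s * r⁻¹) δ → r * r = 1 → ¬ height δ < height γ := by
      intro r hr δ hδ hδr hrr hlt
      refine absurd (hmin δ ⟨hδ, _, hδr, fun hmem => hsn ?_⟩) (not_le.2 hlt)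
      have h3 := dihedralOdd_mul_mul hr1 hr2 hr hmem hr
      have e : r⁻¹ = r := inv_eq_of_mul_eq_one_left hrr
      rw [e] at h3
      have h4 : r * (r * s * r) * r = s := by
        calc r * (r * s * r) * r = (r * r) * s * (r * r) := by group
          _ = s := by rw [hrr]; group
      rwa [h4] at h3
    obtain ⟨hγ1, hγ2⟩ := hψ γ hγ
    have heq : γ = (ψ₂ γ / ψ₂ β₁) • β₁ + (ψ₁ γ / ψ₁ β₂) • β₂ := by
      rw [← sub_eq_zero]
      refine hsep _ (P.sub_mem hγ.2.2 (P.add_mem (P.smul_mem _ h1P) (P.smul_mem _ h2P))) ?_ ?_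
      · rw [map_sub, map_add, map_smul, map_smul, h11, smul_eq_mul, smul_eq_mul]
        field_simp
        ring
      · rw [map_sub, map_add, map_smul, map_smul, h22, smul_eq_mul, smul_eq_mul]
        field_simp
        ring
    rcases hγ1.eq_or_lt with hγ1 | hγ1
    · rw [← hγ1, zero_div, zero_smul, add_zero] at heq
      rw [heq] at hs
      exact hsn (h1.eq_of_eq_smul hs ▸ left_mem_dihedralOdd r₁ r₂)
    rcases hγ2.eq_or_lt with hγ2 | hγ2
    · rw [← hγ2, zero_div, zero_smul, zero_add] at heq
      rw [heq] at hs
      exact hsn (h2.eq_of_eq_smul hs ▸ right_mem_dihedralOdd hr2)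
    have hQγ : 0 < Q γ β₁ ∨ 0 < Q γ β₂ := by
      by_contra! hneg
      have h3 := hQ.pos γ hs.ne_zero
      have h4 : Q γ γ = (ψ₂ γ / ψ₂ β₁) * Q γ β₁ + (ψ₁ γ / ψ₁ β₂) * Q γ β₂ := by
        conv_lhs => rw [heq, map_add, map_smul, map_smul, ← heq]
        simp
      have h5 := mul_nonneg (div_pos hγ2 h21).le (neg_nonneg.2 hneg.1)
      have h6 := mul_nonneg (div_pos hγ1 h12).le (neg_nonneg.2 hneg.2)
      linarith
    rcases hQγ with hq | hq
    · obtain ⟨δ, hδ, hδr, hlt⟩ := reflect_mem_positiveRootsIn h1 h1P h1n hs hγ.2.2 hQ hq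
        (fun δ hδ => (hψ δ hδ).1) h11 hγ1
      exact reduce _ (left_mem_dihedralOdd r₁ r₂) δ hδ hδr hr1 hlt
    · obtain ⟨δ, hδ, hδr, hlt⟩ := reflect_mem_positiveRootsIn h2 h2P h2n hs hγ.2.2 hQ hq
        (fun δ hδ => (hψ δ hδ).2) h22 hγ2
      exact reduce _ (right_mem_dihedralOdd hr2) δ hδ hδr hr2 hlt
  intro s γ hs hγ
  by_contra hsn
  have hall : ∀ γ, γ ∈ P → IsRoot cs hM s γ → 0 ≤ γ → False := by
    intro γ hγ hs h0
    have : γ ∈ ({γ | γ ∈ positiveRootsIn cs hM P ∧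
        ∃ s, IsRoot cs hM s γ ∧ s ∉ dihedralOdd r₁ r₂} : Set (B →₀ ℝ)) :=
      ⟨⟨⟨s, hs⟩, h0, hγ⟩, s, hs, hsn⟩
    rw [main] at this
    exact this
  rcases hs.nonneg_or_nonpos with h | h
  · exact hall γ hγ hs h
  · exact hall (-γ) (P.neg_mem hγ) hs.neg (neg_nonneg.2 h)

variable (cs hM) in
/-- `t` is a reflection with a root in `P`. -/
def HasRootIn (P : Submodule ℝ (B →₀ ℝ)) (t : W) : Prop := ∃ β ∈ P, IsRoot cs hM t β

theorem HasRootIn.left_of_mul_eq [Finite W] {P : Submodule ℝ (B →₀ ℝ)} {t₁ t₂ t₃ t₄ : W}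
    (h1 : HasRootIn cs hM P t₁) (h2 : HasRootIn cs hM P t₂) (h3 : cs.IsReflection t₃)
    (h4 : cs.IsReflection t₄) (hne : t₃ ≠ t₄) (h : t₁ * t₂ = t₃ * t₄) :
    HasRootIn cs hM P t₃ := by
  obtain ⟨β₁, hβ₁, h1⟩ := h1
  obtain ⟨β₂, hβ₂, h2⟩ := h2
  obtain ⟨β₃, h3, -⟩ := exists_nonneg_root hM h3
  obtain ⟨β₄, h4, -⟩ := exists_nonneg_root hM h4
  obtain ⟨Q, hQ1, hQ2, hQ3⟩ := exists_invariant_form cs hM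
  have hQ : IsInvariantForm cs hM Q := ⟨hQ1, hQ2, hQ3⟩
  refine ⟨β₃, ?_, h3⟩
  have p3 := hQ.pos _ h3.ne_zero
  have p4 := hQ.pos _ h4.ne_zero
  set c := Q β₃ β₄ / Q β₄ β₄ with hc
  set x := β₃ - c • β₄ with hx
  have hx4 : Q x β₄ = 0 := by
    rw [hx, map_sub, map_smul, LinearMap.sub_apply, LinearMap.smul_apply, smul_eq_mul, hc]
    field_simp
    ring
  have hx0 : x ≠ 0 := by
    intro h0
    rw [hx, sub_eq_zero] at h0
    rw [h0] at h3
    exact hne (h4.eq_of_eq_smul h3).symm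
  have hx3 : 0 < Q x β₃ := by
    have e : Q x x = Q x β₃ := by
      conv_lhs => rw [hx, map_sub, map_smul, ← hx, hx4]
      simp
    rw [← e]
    exact hQ.pos x hx0
  clear_value x
  have e1 : geomRep cs hM (t₃ * t₄) x = x - (2 * Q x β₃ / Q β₃ β₃) • β₃ := by
    rw [map_mul, LinearEquiv.mul_apply, hQ.apply_reflection h4, hx4, mul_zero, zero_div, zero_smul,
      sub_zero, hQ.apply_reflection h3]
  have e2 : x - geomRep cs hM (t₁ * t₂) x ∈ P := by
    rw [map_mul, LinearEquiv.mul_apply, hQ.apply_reflection h2, hQ.apply_reflection h1, sub_sub,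
      sub_sub_cancel]
    exact P.add_mem (P.smul_mem _ hβ₂) (P.smul_mem _ hβ₁)
  rw [h, e1, sub_sub_cancel] at e2
  exact (P.smul_mem_iff (div_pos (mul_pos two_pos hx3) p3).ne').1 e2

theorem HasRootIn.isReflection_mul [Finite W] {t t' t₁ t₂ t₃ : W} {β β' : B →₀ ℝ}
    (hβ : IsRoot cs hM t β) (hβ' : IsRoot cs hM t' β') (hne : t ≠ t')
    (h1 : HasRootIn cs hM (Submodule.span ℝ {β, β'}) t₁)
    (h2 : HasRootIn cs hM (Submodule.span ℝ {β, β'}) t₂)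
    (h3 : HasRootIn cs hM (Submodule.span ℝ {β, β'}) t₃) : cs.IsReflection (t₁ * t₂ * t₃) := by
  obtain ⟨r₁, r₂, hr1, hr2, H⟩ := exists_dihedralOdd hβ hβ' hne
  obtain ⟨β₁, hβ₁, h1⟩ := h1
  obtain ⟨β₂, hβ₂, h2⟩ := h2
  obtain ⟨β₃, hβ₃, h3⟩ := h3
  exact isReflection_of_mem_dihedralOdd hr1 hr2 (dihedralOdd_mul_mul hr1.mul_self hr2.mul_self
    (H _ _ h1 hβ₁) (H _ _ h2 hβ₂) (H _ _ h3 hβ₃))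

/-! ### The Bruhat graph -/

/-- Adjacency in the Bruhat graph. -/
def BruhatAdj (cs : CoxeterSystem M W) (a b : W) : Prop := cs.IsReflection (b * a⁻¹)

theorem isReflection_inv_iff {t : W} : cs.IsReflection t⁻¹ ↔ cs.IsReflection t := by
  constructor
  · intro h
    have := h.inv
    rw [inv_inv] at this
    rwa [← this] at h
  · intro h
    rwa [h.inv]

theorem BruhatAdj.symm {a b : W} (h : BruhatAdj cs a b) : BruhatAdj cs b a := by
  rw [BruhatAdj, ← isReflection_inv_iff, mul_inv_rev, inv_inv]
  exact h

theorem bruhatAdj_iff {a b : W} : BruhatAdj cs a b ↔ cs.IsReflection (a⁻¹ * b) := by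
  constructor
  · intro h
    have := h.conj a⁻¹
    rwa [inv_inv, mul_assoc, mul_assoc, inv_mul_cancel, mul_one] at this
  · intro h
    have := h.conj a
    rwa [mul_inv_cancel_left] at this

theorem BruhatStep.adj {a b : W} (h : BruhatStep cs a b) : BruhatAdj cs a b := by
  obtain ⟨t, ht, rfl, -⟩ := h
  rwa [BruhatAdj, mul_inv_cancel_right]

theorem BruhatStep.length_lt {a b : W} (h : BruhatStep cs a b) : cs.length a < cs.length b := by
  obtain ⟨t, -, -, h⟩ := h
  exact h

theorem BruhatStep.le {a b : W} (h : BruhatStep cs a b) : BruhatLE cs a b :=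
  Relation.ReflTransGen.single h

theorem BruhatAdj.step {a b : W} (h : BruhatAdj cs a b) (hl : cs.length a < cs.length b) :
    BruhatStep cs a b := ⟨_, h, by group, hl⟩

theorem BruhatAdj.length_mod_two {a b : W} (h : BruhatAdj cs a b) :
    cs.length a % 2 ≠ cs.length b % 2 := by
  have h1 := cs.length_mul_mod_two (b * a⁻¹) a
  rw [inv_mul_cancel_right] at h1
  obtain ⟨k, hk⟩ := h.odd_length
  omega

theorem BruhatAdj.step_or_step {a b : W} (h : BruhatAdj cs a b) :
    BruhatStep cs a b ∨ BruhatStep cs b a := by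
  have := h.length_mod_two
  rcases lt_or_gt_of_ne (fun e => this (by rw [e]) : cs.length a ≠ cs.length b) with h1 | h1
  · exact Or.inl (h.step h1)
  · exact Or.inr (h.symm.step h1)

theorem bruhatStep_mul_simple_of_lt {a : W} {i : B}
    (h : cs.length a < cs.length (a * cs.simple i)) : BruhatStep cs a (a * cs.simple i) :=
  ⟨a * cs.simple i * a⁻¹, ⟨a, i, rfl⟩, by group, h⟩

theorem mul_simple_eq_iff {a b : W} {i : B} : a * cs.simple i = b ↔ a = b * cs.simple i := by
  constructor
  · rintro rfl
    simp
  · rintro rfl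
    simp

/-- A step of the Bruhat order can be transported along right multiplication by a simple
reflection. -/
theorem BruhatStep.of_mul_simple [Finite W] (hM : IsCrystallographic M) {x y : W} {i : B}
    (h : BruhatStep cs (x * cs.simple i) y) (hne : x ≠ y) : BruhatStep cs x (y * cs.simple i) := by
  have h1 := h.mul_simple hM (i := i) (by simpa using hne)
  simpa using h1

variable (cs hM) in
/-- `a` and `b` are joined by an edge of the Bruhat graph whose root lies in `P`. -/
def EdgeIn (P : Submodule ℝ (B →₀ ℝ)) (a b : W) : Prop := HasRootIn cs hM P (b * a⁻¹)

theorem EdgeIn.symm {P : Submodule ℝ (B →₀ ℝ)} {a b : W} (h : EdgeIn cs hM P a b) :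
    EdgeIn cs hM P b a := by
  obtain ⟨β, hβ, hr⟩ := h
  refine ⟨β, hβ, ?_⟩
  rwa [← hr.isReflection.inv, mul_inv_rev, inv_inv] at hr

theorem EdgeIn.of_cycle [Finite W] {P : Submodule ℝ (B →₀ ℝ)} {a b c d : W}
    (h1 : EdgeIn cs hM P a b) (h2 : EdgeIn cs hM P b c) (h3 : BruhatAdj cs a d)
    (h4 : BruhatAdj cs d c) (hne : a ≠ c) : EdgeIn cs hM P a d ∧ EdgeIn cs hM P d c := by
  have key : ∀ {a c : W}, EdgeIn cs hM P a b → EdgeIn cs hM P b c → BruhatAdj cs a d →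
      BruhatAdj cs d c → a ≠ c → EdgeIn cs hM P d c := by
    intro a c h1 h2 h3 h4 hne
    refine HasRootIn.left_of_mul_eq h2 h1 h4 h3 (fun h => hne ?_) (by group)
    have h5 := h3.mul_self
    nth_rewrite 1 [← h] at h5
    rw [← mul_assoc, inv_mul_cancel_right] at h5
    exact (mul_inv_eq_one.1 h5).symm
  exact ⟨(key h2.symm h1.symm h4.symm h3.symm hne.symm).symm, key h1 h2 h3 h4 hne⟩

variable (cs hM) in
theorem exists_plane [Finite W] {a b c : W} (h1 : BruhatAdj cs a b) (h2 : BruhatAdj cs b c)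
    (hne : a ≠ c) : ∃ P, EdgeIn cs hM P a b ∧ EdgeIn cs hM P b c ∧
      ∀ p q r s, EdgeIn cs hM P p q → EdgeIn cs hM P q r → EdgeIn cs hM P r s →
        BruhatAdj cs p s := by
  obtain ⟨β, hβ, -⟩ := exists_nonneg_root hM h1
  obtain ⟨β', hβ', -⟩ := exists_nonneg_root hM h2
  have hne' : b * a⁻¹ ≠ c * b⁻¹ := by
    intro h
    have h5 := h1.mul_self
    nth_rewrite 1 [h] at h5
    rw [← mul_assoc, inv_mul_cancel_right] at h5
    exact hne (mul_inv_eq_one.1 h5).symm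
  refine ⟨Submodule.span ℝ {β, β'}, ⟨β, Submodule.subset_span (by simp), hβ⟩,
    ⟨β', Submodule.subset_span (by simp), hβ'⟩, fun p q r s hp hq hr => ?_⟩
  have := HasRootIn.isReflection_mul hβ hβ' hne' hr hq hp
  have e : s * r⁻¹ * (r * q⁻¹) * (q * p⁻¹) = s * p⁻¹ := by group
  rwa [e] at this

/-- A copy of `K₃,₃` minus an edge in the Bruhat graph extends to a copy of `K₃,₃`. -/
theorem bruhatAdj_of_K33 [Finite W] (hM : IsCrystallographic M) {p₀ p₁ p₂ q₀ q₁ q₂ : W}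
    (hp : p₁ ≠ p₂) (hq : q₁ ≠ q₂) (h01 : BruhatAdj cs p₀ q₁) (h02 : BruhatAdj cs p₀ q₂)
    (h10 : BruhatAdj cs p₁ q₀) (h11 : BruhatAdj cs p₁ q₁) (h12 : BruhatAdj cs p₁ q₂)
    (h20 : BruhatAdj cs p₂ q₀) (h21 : BruhatAdj cs p₂ q₁) (h22 : BruhatAdj cs p₂ q₂) :
    BruhatAdj cs p₀ q₀ := by
  obtain ⟨P, e1, e2, H⟩ := exists_plane cs hM h11 h21.symm hp
  have e3 := EdgeIn.of_cycle e1 e2 h12 h22.symm hp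
  have e4 := EdgeIn.of_cycle e1 e2 h10 h20.symm hp
  have e5 := EdgeIn.of_cycle e1.symm e3.1 h01.symm h02 hq
  exact H _ _ _ _ e5.1.symm e1.symm e4.1

theorem bruhatAdj_of_path [Finite W] (hM : IsCrystallographic M) {u a b v x y : W}
    (hub : u ≠ b) (hav : a ≠ v) (hua : BruhatAdj cs u a) (hab : BruhatAdj cs a b)
    (hbv : BruhatAdj cs b v) (huv : BruhatAdj cs u v) (huy : BruhatAdj cs u y)
    (hyb : BruhatAdj cs y b) (hax : BruhatAdj cs a x) (hxv : BruhatAdj cs x v) :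
    BruhatAdj cs y x := by
  obtain ⟨P, e1, e2, H⟩ := exists_plane cs hM hua hab hub
  have e3 := EdgeIn.of_cycle e1 e2 huv hbv.symm hub
  have e4 := EdgeIn.of_cycle e1 e2 huy hyb hub
  have e5 := EdgeIn.of_cycle e2 e3.2.symm hax hxv hav
  exact H _ _ _ _ e4.2 e3.2.symm e5.2.symm

theorem exists_length_mul_simple_lt {x : W} (hx : 0 < cs.length x) :
    ∃ i, cs.length (x * cs.simple i) + 1 = cs.length x := by
  obtain ⟨i, hi⟩ := cs.exists_rightDescent_of_ne_one (w := x) (by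
    rintro rfl
    simp at hx)
  exact ⟨i, cs.isRightDescent_iff.1 hi⟩

theorem exists_ne_step_step [Finite W] (hM : IsCrystallographic M) {u a x : W}
    (h1 : BruhatStep cs u a) (h2 : BruhatStep cs a x) :
    ∃ a', a' ≠ a ∧ BruhatStep cs u a' ∧ BruhatStep cs a' x := by
  induction hn : cs.length x using Nat.strong_induction_on generalizing u a x with
  | _ n ih =>
  subst hn
  have l1 := h1.length_lt
  have l2 := h2.length_lt
  obtain ⟨i, hi⟩ := exists_length_mul_simple_lt (cs := cs) (x := x) (by omega)
  have hxs : BruhatStep cs (x * cs.simple i) x := by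
    have := bruhatStep_mul_simple_of_lt (cs := cs) (a := x * cs.simple i) (i := i)
      (by simp; omega)
    simpa using this
  have hne : ∀ {p q : W}, cs.length p < cs.length q → p ≠ q := fun h e => by simp [e] at h
  have lift : ∀ a', BruhatStep cs (u * cs.simple i) a' → BruhatStep cs a' (x * cs.simple i) →
      u ≠ a' → BruhatStep cs u (a' * cs.simple i) ∧ BruhatStep cs (a' * cs.simple i) x := by
    intro a' h3 h4 h5
    refine ⟨h3.of_mul_simple hM h5, ?_⟩
    have h6 := h4.length_lt
    have := h4.mul_simple hM (i := i) (fun e => by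
      rw [mul_left_inj] at e
      subst e
      omega)
    simpa using this
  rcases cs.length_mul_simple u i with hu | hu
  · by_cases ha : u * cs.simple i = a
    · rw [← ha] at h2 ⊢
      exact ⟨x * cs.simple i, fun e => hne (l1.trans l2) (mul_right_cancel e).symm,
        h2.of_mul_simple hM (hne (l1.trans l2)), hxs⟩
    by_cases ha' : a * cs.simple i = x
    · rw [mul_simple_eq_iff] at ha'
      subst ha'
      refine ⟨u * cs.simple i, ha, bruhatStep_mul_simple_of_lt (by omega), ?_⟩
      simpa using h1.mul_simple hM ha
    obtain ⟨a', h3, h4, h5⟩ := ih _ (by omega) (h1.mul_simple hM ha) (h2.mul_simple hM ha') rfl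
    have h6 := h4.length_lt
    obtain ⟨h7, h8⟩ := lift a' h4 h5 (hne (by omega))
    exact ⟨_, fun e => h3 (mul_simple_eq_iff.1 e), h7, h8⟩
  · have hus : BruhatStep cs (u * cs.simple i) u := by
      have := bruhatStep_mul_simple_of_lt (cs := cs) (a := u * cs.simple i) (i := i)
        (by simp; omega)
      simpa using this
    by_cases ha : a * cs.simple i = x
    · obtain ⟨a', h3, h4, h5⟩ := ih _ l2 hus h1 rfl
      have h6 := h5.length_lt
      rw [mul_simple_eq_iff] at ha
      rw [ha] at h5
      obtain ⟨h7, h8⟩ := lift a' h4 h5 h3.symm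
      refine ⟨_, fun e => ?_, h7, h8⟩
      rw [ha, mul_left_inj] at e
      subst e
      omega
    · obtain ⟨a', h3, h4, h5⟩ := ih _ (by omega) (h1.mul_simple hM (hne (by omega)))
        (h2.mul_simple hM ha) rfl
      by_cases hau : u = a'
      · subst hau
        exact ⟨_, fun e => ha (mul_simple_eq_iff.1 e).symm, h5, hxs⟩
      · obtain ⟨h7, h8⟩ := lift a' h4 h5 hau
        exact ⟨_, fun e => h3 (mul_simple_eq_iff.1 e), h7, h8⟩

theorem exists_step_step_step [Finite W] (hM : IsCrystallographic M) {u v : W}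
    (h : BruhatStep cs u v) (hl : cs.length u + 2 ≤ cs.length v) :
    ∃ a b, BruhatStep cs u a ∧ BruhatStep cs a b ∧ BruhatStep cs b v := by
  induction hn : cs.length v using Nat.strong_induction_on generalizing u v with
  | _ n ih =>
  subst hn
  obtain ⟨i, hi⟩ := exists_length_mul_simple_lt (cs := cs) (x := v) (by omega)
  have hvs : BruhatStep cs (v * cs.simple i) v := by
    have := bruhatStep_mul_simple_of_lt (cs := cs) (a := v * cs.simple i) (i := i)
      (by simp; omega)
    simpa using this
  have hne : ∀ {p q : W}, cs.length p < cs.length q → p ≠ q := fun h e => by simp [e] at h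
  have hl' : cs.length (u * cs.simple i) < cs.length v := by
    rcases cs.length_mul_simple u i with hu | hu <;> omega
  have h' := h.mul_simple hM (hne hl')
  rcases cs.length_mul_simple u i with hu | hu
  · exact ⟨_, _, bruhatStep_mul_simple_of_lt (by omega), h', hvs⟩
  obtain ⟨a, b, h1, h2, h3⟩ := ih _ (by omega) h' (by omega) rfl
  have l3 := h3.length_lt
  have hbv : BruhatStep cs (b * cs.simple i) v := by
    have := h3.mul_simple hM (i := i) (fun e => by
      rw [mul_left_inj] at e
      subst e
      omega)
    simpa using this
  have key : ∀ a', BruhatStep cs (u * cs.simple i) a' → BruhatStep cs a' b →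
      a' * cs.simple i ≠ b →
      ∃ a b, BruhatStep cs u a ∧ BruhatStep cs a b ∧ BruhatStep cs b v := by
    intro a' h4 h5 h6
    by_cases hau : u = a'
    · subst hau
      exact ⟨_, _, h5, h3, hvs⟩
    · exact ⟨_, _, h4.of_mul_simple hM hau, h5.mul_simple hM h6, hbv⟩
  by_cases hab : a * cs.simple i = b
  · obtain ⟨a', h4, h5, h6⟩ := exists_ne_step_step hM h1 h2
    exact key a' h5 h6 fun e => h4 (mul_right_cancel (e.trans hab.symm))
  · exact key a h1 h2 hab

theorem BruhatLE.step_of_length {a b : W} (h : BruhatLE cs a b)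
    (hl : cs.length b = cs.length a + 1) : BruhatStep cs a b := by
  rcases Relation.ReflTransGen.cases_head h with rfl | ⟨c, hc, h'⟩
  · omega
  · by_cases hcb : c = b
    · rwa [hcb] at hc
    · have h1 := hc.length_lt
      have h2 := BruhatLE.length_lt h' hcb
      omega

/-! ### Special matchings of lower intervals in the dual order -/

/-- A special matching of the Bruhat interval `[y, w]`, as a function on the whole group. -/
structure IsIntervalMatching (cs : CoxeterSystem M W) (y w : W) (g : W → W) : Prop where
  left_le : ∀ p, BruhatLE cs y p → BruhatLE cs p w → BruhatLE cs y (g p)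
  le_right : ∀ p, BruhatLE cs y p → BruhatLE cs p w → BruhatLE cs (g p) w
  invol : ∀ p, BruhatLE cs y p → BruhatLE cs p w → g (g p) = p
  step : ∀ p, BruhatLE cs y p → BruhatLE cs p w →
    (BruhatStep cs (g p) p ∧ cs.length p = cs.length (g p) + 1) ∨
    (BruhatStep cs p (g p) ∧ cs.length (g p) = cs.length p + 1)
  special : ∀ p q, BruhatLE cs y p → BruhatLE cs q w → BruhatStep cs p q →
    cs.length q = cs.length p + 1 → g p = q ∨ (BruhatLE cs (g p) (g q) ∧ g p ≠ g q)

theorem IsIntervalMatching.eq_of_eq {y w : W} {g : W → W} (hg : IsIntervalMatching cs y w g)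
    {p q : W} (hp : BruhatLE cs y p) (hp' : BruhatLE cs p w) (hq : BruhatLE cs y q)
    (hq' : BruhatLE cs q w) (h : g p = g q) : p = q := by
  rw [← hg.invol p hp hp', h, hg.invol q hq hq']

theorem IsIntervalMatching.adj_of_cover [Finite W] (hM : IsCrystallographic M) {y w : W}
    {g : W → W} (hg : IsIntervalMatching cs y w g) {p q : W} (hp : BruhatLE cs y p)
    (hq : BruhatLE cs q w) (h : BruhatStep cs p q) (hl : cs.length q = cs.length p + 1) :
    BruhatAdj cs (g p) (g q) := by
  have hp' : BruhatLE cs p w := h.le.trans hq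
  have hq' : BruhatLE cs y q := hp.trans h.le
  have sp := hg.step p hp hp'
  have sq := hg.step q hq' hq
  rcases hg.special p q hp hq h hl with e | ⟨e1, e2⟩
  · have e' := hg.invol p hp hp'
    rw [e] at e' ⊢
    rw [e']
    exact h.adj.symm
  have l := BruhatLE.length_lt e1 e2
  by_cases hl' : cs.length (g q) = cs.length (g p) + 1
  · exact (e1.step_of_length hl').adj
  have sp' := sp.resolve_right (by omega)
  have sq' := sq.resolve_left (by omega)
  have hgq : BruhatLE cs (g q) w := hg.le_right q hq' hq
  have hgp : BruhatLE cs y (g p) := hg.left_le p hp hp'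
  obtain ⟨b, hbq, hpb, hbgq⟩ := exists_ne_step_step hM h sq'.1
  have lb1 := hpb.length_lt
  have lb2 := hbgq.length_lt
  have hb : BruhatLE cs y b := hp.trans hpb.le
  have hb' : BruhatLE cs b w := hbgq.le.trans hgq
  have hgb : BruhatLE cs y (g b) := hg.left_le b hb hb'
  have hgb' : BruhatLE cs (g b) w := hg.le_right b hb hb'
  have hlb : cs.length (g b) < cs.length q := by
    rcases hg.special b (g q) hb hgq hbgq (by omega) with e | ⟨e3, e4⟩
    · exact absurd (hg.eq_of_eq hb hb' hq' hq e) hbq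
    · rw [hg.invol q hq' hq] at e3 e4
      exact BruhatLE.length_lt e3 e4
  have sb := (hg.step b hb hb').resolve_right (by omega)
  have hpgb : BruhatStep cs (g p) (g b) := by
    rcases hg.special p b hp hb' hpb (by omega) with e | ⟨e3, e4⟩
    · rw [e] at sp'
      omega
    · exact e3.step_of_length (by omega)
  obtain ⟨c, hcb, hgbc, hcgq⟩ := exists_ne_step_step hM sb.1 hbgq
  have lc1 := hgbc.length_lt
  have lc2 := hcgq.length_lt
  have hc : BruhatLE cs y c := hgb.trans hgbc.le
  have hc' : BruhatLE cs c w := hcgq.le.trans hgq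
  have hcq : c = q := by
    rcases hg.special c (g q) hc hgq hcgq (by omega) with e | ⟨e3, e4⟩
    · exact hg.eq_of_eq hc hc' hq' hq e
    exfalso
    rw [hg.invol q hq' hq] at e3 e4
    have l3 := BruhatLE.length_lt e3 e4
    have sc := (hg.step c hc hc').resolve_right (by omega)
    rcases hg.special (g b) c hgb hc' hgbc (by omega) with e | ⟨e5, e6⟩
    · rw [hg.invol b hb hb'] at e
      exact hcb e.symm
    · rw [hg.invol b hb hb'] at e5 e6
      have l4 := BruhatLE.length_lt e5 e6
      omega
  subst hcq
  refine bruhatAdj_of_K33 hM hbq.symm (q₁ := p) (q₂ := g b) ?_ sp'.1.adj hpgb.adj sq'.1.adj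
    h.adj.symm hgbc.adj.symm hbgq.adj hpb.adj.symm sb.1.adj.symm
  intro e
  have e' := hg.invol b hb hb'
  rw [← e] at e'
  rw [e'] at sp'
  omega

/-- Special matchings of Bruhat intervals preserve the edges of the Bruhat graph. -/
theorem IsIntervalMatching.adj [Finite W] (hM : IsCrystallographic M) {y w : W} {g : W → W}
    (hg : IsIntervalMatching cs y w g) {u v : W} (hu : BruhatLE cs y u) (hv : BruhatLE cs v w)
    (h : BruhatStep cs u v) : BruhatAdj cs (g u) (g v) := by
  induction hn : cs.length v - cs.length u using Nat.strong_induction_on generalizing u v with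
  | _ n ih =>
  subst hn
  have l := h.length_lt
  by_cases hl : cs.length v = cs.length u + 1
  · exact hg.adj_of_cover hM hu hv h hl
  obtain ⟨a, b, hua, hab, hbv⟩ := exists_step_step_step hM h (by omega)
  obtain ⟨y', hy'a, huy', hy'b⟩ := exists_ne_step_step hM hua hab
  obtain ⟨x, hxb, hax, hxv⟩ := exists_ne_step_step hM hab hbv
  have l1 := hua.length_lt
  have l2 := hab.length_lt
  have l3 := hbv.length_lt
  have l4 := huy'.length_lt
  have l5 := hy'b.length_lt
  have l6 := hax.length_lt
  have l7 := hxv.length_lt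
  have ha := hu.trans hua.le
  have hb := ha.trans hab.le
  have hy := hu.trans huy'.le
  have hx := ha.trans hax.le
  have hb' := hbv.le.trans hv
  have ha' := hab.le.trans hb'
  have hy' := hy'b.le.trans hb'
  have hx' := hxv.le.trans hv
  have hyx : BruhatAdj cs y' x := bruhatAdj_of_path hM (fun e => by subst e; omega)
    (fun e => by subst e; omega) hua.adj hab.adj hbv.adj h.adj huy'.adj hy'b.adj hax.adj hxv.adj
  have hgyx : BruhatAdj cs (g y') (g x) := by
    rcases hyx.step_or_step with h1 | h1
    · exact ih _ (by have := h1.length_lt; omega) hy hx' h1 rfl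
    · exact (ih _ (by have := h1.length_lt; omega) hx hy' h1 rfl).symm
  refine bruhatAdj_of_K33 hM (p₁ := g b) (p₂ := g x) (q₁ := g a) (q₂ := g y')
    (fun e => hxb (hg.eq_of_eq hb hb' hx hx' e).symm)
    (fun e => hy'a (hg.eq_of_eq ha ha' hy hy' e).symm)
    (ih _ (by omega) hu ha' hua rfl) (ih _ (by omega) hu hy' huy' rfl)
    (ih _ (by omega) hb hv hbv rfl) (ih _ (by omega) ha hb' hab rfl).symm
    (ih _ (by omega) hy hb' hy'b rfl).symm (ih _ (by omega) hx hv hxv rfl)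
    (ih _ (by omega) ha hx' hax rfl).symm hgyx.symm

theorem bruhatDeg_self_top {w : W} : bruhatDeg cs w w w = 0 := by
  rw [bruhatDeg, Nat.card_eq_zero]
  left
  constructor
  rintro ⟨z, ⟨h1, h2⟩, h3⟩
  rw [← bruhatAdj_iff, ← BruhatLE.antisymm h1 h2] at h3
  exact h3.length_mod_two rfl

theorem BruhatLE.step_of_adj {a b : W} (h : BruhatLE cs a b) (h' : BruhatAdj cs a b) :
    BruhatStep cs a b :=
  h'.step (BruhatLE.length_lt h fun e => h'.length_mod_two (by rw [e]))

theorem IsIntervalMatching.step_bot {y w : W} {g : W → W}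
    (hg : IsIntervalMatching cs y w g) (hyw : BruhatLE cs y w) :
    BruhatStep cs y (g y) ∧ cs.length (g y) = cs.length y + 1 := by
  refine (hg.step y .refl hyw).resolve_left fun h => ?_
  have := (hg.left_le y .refl hyw).length_le
  omega

theorem IsIntervalMatching.bruhatDeg_eq [Finite W] (hM : IsCrystallographic M) {y w : W}
    {g : W → W} (hg : IsIntervalMatching cs y w g) (hyw : BruhatLE cs y w) :
    bruhatDeg cs y w y = bruhatDeg cs (g y) w (g y) + 1 := by
  obtain ⟨hs, hl⟩ := hg.step_bot hyw
  have hgw := hg.le_right y .refl hyw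
  have hA : ∀ x : W, bruhatDeg cs x w x =
      {z | (BruhatLE cs x z ∧ BruhatLE cs z w) ∧ BruhatAdj cs x z}.ncard := by
    intro x
    simp only [bruhatAdj_iff]
    rfl
  rw [hA, hA]
  have hgy : g y ∉ g '' {z | (BruhatLE cs (g y) z ∧ BruhatLE cs z w) ∧ BruhatAdj cs (g y) z} := by
    rintro ⟨z, ⟨⟨h1, h2⟩, h3⟩, e⟩
    have e' := hg.eq_of_eq (hs.le.trans h1) h2 .refl hyw e
    have h4 := h1.length_le
    rw [e'] at h4
    omega
  rw [← Set.InjOn.ncard_image (f := g)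
    (s := {z | (BruhatLE cs (g y) z ∧ BruhatLE cs z w) ∧ BruhatAdj cs (g y) z}),
    ← Set.ncard_insert_of_notMem hgy]
  · congr 1
    ext z
    simp only [Set.mem_ofPred_eq, Set.mem_insert_iff, Set.mem_image]
    constructor
    · rintro ⟨⟨h1, h2⟩, h3⟩
      refine or_iff_not_imp_left.2 fun hne => ⟨g z, ⟨⟨?_, hg.le_right z h1 h2⟩, ?_⟩,
        hg.invol z h1 h2⟩
      · rcases (hg.adj hM .refl h2 (h1.step_of_adj h3)).step_or_step with h4 | h4
        · exact h4.le
        · exfalso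
          have h5 := h4.length_lt
          have h6 := hg.left_le z h1 h2
          have e : y = g z := by
            by_contra e
            have := BruhatLE.length_lt h6 e
            omega
          rw [e, hg.invol z h1 h2] at hne
          exact hne rfl
      · exact hg.adj hM .refl h2 (h1.step_of_adj h3)
    · rintro (rfl | ⟨z, ⟨⟨h1, h2⟩, h3⟩, rfl⟩)
      · exact ⟨⟨hs.le, hgw⟩, hs.adj⟩
      · have h4 := hg.adj hM hs.le h2 (h1.step_of_adj h3)
        rw [hg.invol y .refl hyw] at h4
        have h5 := hs.le.trans h1
        exact ⟨⟨hg.left_le z h5 h2, hg.le_right z h5 h2⟩, h4⟩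
  · rintro p ⟨⟨h1, h2⟩, -⟩ q ⟨⟨h3, h4⟩, -⟩ e
    exact hg.eq_of_eq (hs.le.trans h1) h2 (hs.le.trans h3) h4 e

theorem exists_isIntervalMatching [Finite W] (hM : IsCrystallographic M) {u w : W}
    (y : BruhatInterval cs u w)
    {f : {v : (BruhatInterval cs u w)ᵒᵈ // v ≤ OrderDual.toDual y} →
      {v : (BruhatInterval cs u w)ᵒᵈ // v ≤ OrderDual.toDual y}} (hf : IsSpecialMatching f) :
    ∃ g, IsIntervalMatching cs y.1 w g := by
  classical
  let val (x : {v : (BruhatInterval cs u w)ᵒᵈ // v ≤ OrderDual.toDual y}) : W :=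
    (OrderDual.ofDual x.1).1
  let mk (z : W) (h : BruhatLE cs y.1 z ∧ BruhatLE cs z w) :
      {v : (BruhatInterval cs u w)ᵒᵈ // v ≤ OrderDual.toDual y} :=
    ⟨OrderDual.toDual ⟨z, y.2.1.trans h.1, h.2⟩, h.1⟩
  have hle : ∀ {a b}, a ≤ b ↔ BruhatLE cs (val b) (val a) := Iff.rfl
  have hval : ∀ x, BruhatLE cs y.1 (val x) ∧ BruhatLE cs (val x) w := fun x => ⟨x.2, x.1.2.2⟩
  have hmk : ∀ x, mk (val x) (hval x) = x := fun x => rfl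
  have hinj : ∀ {a b}, val a = val b → a = b := fun h => Subtype.ext (Subtype.ext h)
  have hlt : ∀ {a b}, a < b ↔ BruhatLE cs (val b) (val a) ∧ val b ≠ val a := by
    intro a b
    rw [lt_iff_le_and_ne, hle]
    exact and_congr_right fun _ => ⟨fun h e => h (hinj e).symm, fun h e => h (by rw [e])⟩
  have hcov : ∀ {a b}, a ⋖ b ↔
      BruhatStep cs (val b) (val a) ∧ cs.length (val a) = cs.length (val b) + 1 := by
    intro a b
    constructor
    · rintro ⟨h1, h2⟩
      obtain ⟨h3, h4⟩ := hlt.1 h1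
      have hbetween : ∀ c, BruhatStep cs (val b) c → BruhatLE cs c (val a) → c = val a := by
        intro c hc hca
        by_contra hne
        refine h2 (c := mk c ⟨(hval b).1.trans hc.le, hca.trans (hval a).2⟩)
          (hlt.2 ⟨hca, hne⟩) (hlt.2 ⟨hc.le, fun e => ?_⟩)
        have := hc.length_lt
        rw [e] at this
        exact lt_irrefl _ this
      have hs : BruhatStep cs (val b) (val a) := by
        rcases Relation.ReflTransGen.cases_head h3 with e | ⟨c, hc, h'⟩
        · exact absurd e h4
        · have := hbetween c hc h'
          rwa [this] at hc
      refine ⟨hs, ?_⟩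
      have l := hs.length_lt
      by_contra hl
      obtain ⟨c, d, h5, h6, h7⟩ := exists_step_step_step hM hs (by omega)
      have e := hbetween c h5 (h6.le.trans h7.le)
      have l1 := h6.length_lt
      have l2 := h7.length_lt
      rw [e] at l1
      omega
    · rintro ⟨h1, h2⟩
      have hne : val b ≠ val a := fun e => by
        rw [e] at h2
        omega
      refine ⟨hlt.2 ⟨h1.le, hne⟩, fun c h3 h4 => ?_⟩
      obtain ⟨h5, h6⟩ := hlt.1 h3
      obtain ⟨h7, h8⟩ := hlt.1 h4
      have l1 := BruhatLE.length_lt h5 h6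
      have l2 := BruhatLE.length_lt h7 h8
      omega
  let g (z : W) : W := if h : BruhatLE cs y.1 z ∧ BruhatLE cs z w then val (f (mk z h)) else z
  have hg : ∀ x, g (val x) = val (f x) := fun x => dif_pos (hval x)
  have hex : ∀ z, BruhatLE cs y.1 z → BruhatLE cs z w → ∃ x, val x = z :=
    fun z h1 h2 => ⟨mk z ⟨h1, h2⟩, rfl⟩
  clear_value val g
  obtain ⟨⟨hf1, hf2⟩, hf3⟩ := hf
  refine ⟨g, fun p h1 h2 => ?_, fun p h1 h2 => ?_, fun p h1 h2 => ?_, fun p h1 h2 => ?_,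
    fun p q h1 h2 h3 h4 => ?_⟩
  · obtain ⟨x, rfl⟩ := hex p h1 h2
    rw [hg]
    exact (hval _).1
  · obtain ⟨x, rfl⟩ := hex p h1 h2
    rw [hg]
    exact (hval _).2
  · obtain ⟨x, rfl⟩ := hex p h1 h2
    rw [hg, hg, hf1]
  · obtain ⟨x, rfl⟩ := hex p h1 h2
    rw [hg]
    exact (hf2 x).symm.imp hcov.1 hcov.1
  · obtain ⟨x, rfl⟩ := hex p h1 (h3.le.trans h2)
    obtain ⟨z, rfl⟩ := hex q (h1.trans h3.le) h2
    rw [hg, hg]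
    rcases hf3 z x (hcov.2 ⟨h3, h4⟩) with e | h
    · left
      rw [← e, hf1]
    · exact Or.inr (hlt.1 h)

theorem rationallySmooth_of_isZircon [Finite W] (hM : IsCrystallographic M) {u w : W}
    (hz : IsZircon ((BruhatInterval cs u w)ᵒᵈ)) : RationallySmooth cs u w := by
  intro y huy hyw
  induction hn : cs.length w - cs.length y generalizing y with
  | zero =>
    have hyw' : y = w := by
      by_contra hne
      have := BruhatLE.length_lt hyw hne
      omega
    rw [hyw', bruhatDeg_self_top]
  | succ n ih =>
    have hne : y ≠ w := fun e => by simp [e] at hn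
    let yI : BruhatInterval cs u w := ⟨y, huy, hyw⟩
    let wI : BruhatInterval cs u w := ⟨w, huy.trans hyw, .refl⟩
    obtain ⟨-, f, hf⟩ := hz (OrderDual.toDual yI) ⟨OrderDual.toDual wI,
      lt_of_le_of_ne hyw fun e => hne (congrArg (fun x => (OrderDual.ofDual x).1) e).symm⟩
    obtain ⟨g, hg⟩ := exists_isIntervalMatching hM yI hf
    obtain ⟨hs, hl⟩ := hg.step_bot hyw
    change cs.length (g y) = cs.length y + 1 at hl
    rw [hg.bruhatDeg_eq hM hyw,
      ih (g y) (huy.trans hs.le) (hg.le_right y .refl hyw) (by omega)]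

end GeomRep

/-- If the dual of a Bruhat interval `[u,w]` in a Weyl group is a zircon,
then `[u,w]` is rationally smooth. -/
theorem dual_zircon_rationally_smooth {B W : Type*} [Group W] [Finite W] {M : CoxeterMatrix B}
    (cs : CoxeterSystem M W)
    (hcrys : ∀ i j : B, i ≠ j → M i j ∈ ({2, 3, 4, 6} : Set ℕ))
    (u w : W) (huw : BruhatLE cs u w) (hne : u ≠ w)
    (hz : IsZircon ((BruhatInterval cs u w)ᵒᵈ)) :
    RationallySmooth cs u w := by
  exact rationallySmooth_of_isZircon hcrys hz

end Paper
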